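/- arXiv:2002.01971 — 2 statements merged into one kernel-verified Lean document; each statement's English description precedes it below -/
import Mathlib

section
/- Let k ≥ 1 be a natural number and for each l ∈ {1,…,k} let (α_{l,n})_{n≥0} be a sequence of complex numbers with lim_{n→∞} α_{l,n} = α_l ∈ ℂ. Define the sequence (d_n) by d_0 = 1, d_n = 0 for n < 0, and d_{n+1} = α_{1,n} d_n + α_{2,n} d_{n−1} + ⋯ + α_{k,n} d_{n−k+1} for all n ≥ 0. Then for every x ∈ ℂ satisfying ∑_{m=1}^{k} |α_m| |x|^m < 1, the power series ∑_{n=0}^{∞} d_n x^n converges absolutely. -/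
open Filter Finset

/-- A shift of a nonnegative sequence to the right has smaller partial sums. -/
lemma sum_range_shift_le {u : ℕ → ℝ} (hu : ∀ n, 0 ≤ u n) (m L : ℕ) :
    ∑ n ∈ range L, (if m ≤ n then u (n - m) else 0) ≤ ∑ n ∈ range L, u n := by
  have h : ∑ n ∈ range L, (if m ≤ n then u (n - m) else 0) = ∑ n ∈ range (L - m), u n := by
    induction L with
    | zero => simp
    | succ L ih =>
      rw [sum_range_succ, ih]
      split_ifs with hm
      · rw [Nat.succ_sub hm, sum_range_succ]
      · rw [show L + 1 - m = 0 by omega, show L - m = 0 by omega]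
        simp
  rw [h]
  exact sum_le_sum_of_subset_of_nonneg (range_mono (Nat.sub_le L m)) fun n _ _ => hu n

/-- A nonnegative sequence eventually dominated by a linear combination of its right shifts,
with nonnegative coefficients of total sum less than one, is summable. -/
lemma summable_of_eventually_le_sum_shift {u : ℕ → ℝ} (hu : ∀ n, 0 ≤ u n) (s : Finset ℕ)
    {c : ℕ → ℝ} (hc : ∀ m ∈ s, 0 ≤ c m) (hc1 : ∑ m ∈ s, c m < 1)
    (h : ∀ᶠ n in atTop, u n ≤ ∑ m ∈ s, c m * (if m ≤ n then u (n - m) else 0)) :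
    Summable u := by
  obtain ⟨N, hN⟩ := eventually_atTop.1 h
  set S : ℕ → ℝ := fun L => ∑ n ∈ range L, u n with hS
  have hbound : ∀ M, S (N + M) ≤ S N + (∑ m ∈ s, c m) * S (N + M) := by
    intro M
    have hsplit : S (N + M) = S N + ∑ j ∈ range M, u (N + j) := sum_range_add _ _ _
    have hnonneg : ∀ m n : ℕ, 0 ≤ if m ≤ n then u (n - m) else 0 := by
      intro m n
      split_ifs
      exacts [hu _, le_rfl]
    have htail : ∑ j ∈ range M, u (N + j) ≤ (∑ m ∈ s, c m) * S (N + M) :=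
      calc ∑ j ∈ range M, u (N + j)
          ≤ ∑ j ∈ range M, ∑ m ∈ s, c m * (if m ≤ N + j then u (N + j - m) else 0) :=
            sum_le_sum fun j _ => hN (N + j) (Nat.le_add_right N j)
        _ = ∑ m ∈ s, c m * ∑ j ∈ range M, (if m ≤ N + j then u (N + j - m) else 0) := by
            rw [sum_comm]
            simp only [mul_sum]
        _ ≤ ∑ m ∈ s, c m * S (N + M) := by
            refine sum_le_sum fun m hm => mul_le_mul_of_nonneg_left ?_ (hc m hm)
            refine le_trans ?_ (sum_range_shift_le hu m (N + M))
            rw [sum_range_add _ N M]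
            exact le_add_of_nonneg_left (sum_nonneg fun n _ => hnonneg m n)
        _ = (∑ m ∈ s, c m) * S (N + M) := (sum_mul _ _ _).symm
    linarith
  refine summable_of_sum_range_le (c := S N / (1 - ∑ m ∈ s, c m)) hu fun L => ?_
  calc S L ≤ S (N + L) :=
        sum_le_sum_of_subset_of_nonneg (range_mono (Nat.le_add_left L N)) fun n _ _ => hu n
    _ ≤ S N / (1 - ∑ m ∈ s, c m) := by
        rw [le_div_iff₀ (by linarith)]
        linarith [hbound L]

/-- If the coefficients `d n` satisfy the `(k+1)`-term recurrence
`d (n+1) = ∑_{m=1}^{k} α m n * d (n+1-m)` (with `d` of negative index taken to be `0`),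
where each `α m n → αlim m` as `n → ∞`, then for every `x : ℂ` with
`∑_{m=1}^{k} ‖αlim m‖ * ‖x‖^m < 1`, the power series `∑ d n * x^n` converges absolutely. -/
theorem stmt_0 (k : ℕ) (hk : 1 ≤ k) (α : ℕ → ℕ → ℂ) (αlim : ℕ → ℂ)
    (hα : ∀ m, 1 ≤ m → m ≤ k →
      Filter.Tendsto (fun n => α m n) Filter.atTop (nhds (αlim m)))
    (d : ℕ → ℂ) (hd0 : d 0 = 1)
    (hrec : ∀ n : ℕ, d (n + 1) =
      ∑ m ∈ Finset.Icc 1 k, α m n * (if m ≤ n + 1 then d (n + 1 - m) else 0))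
    (x : ℂ) (hx : ∑ m ∈ Finset.Icc 1 k, ‖αlim m‖ * ‖x‖ ^ m < 1) :
    Summable (fun n : ℕ => ‖d n * x ^ n‖) := by
  set r : ℝ := ∑ m ∈ Icc 1 k, ‖αlim m‖ * ‖x‖ ^ m with hr
  have hk0 : (0 : ℝ) < k := by exact_mod_cast hk
  set ε : ℝ := (1 - r) / (2 * k) with hε
  have hε0 : 0 < ε := div_pos (by linarith) (by linarith)
  refine summable_of_eventually_le_sum_shift (fun n => norm_nonneg _) (Icc 1 k)
    (c := fun m => ‖αlim m‖ * ‖x‖ ^ m + ε) (fun m _ => by positivity) ?_ ?_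
  · have hkε : k * ε = (1 - r) / 2 := by
      rw [hε]
      field_simp
    rw [sum_add_distrib, ← hr, sum_const, Nat.card_Icc, nsmul_eq_mul, Nat.add_sub_cancel, hkε]
    linarith
  · have hev : ∀ᶠ n in atTop, ∀ m ∈ Icc 1 k,
        ‖α m n‖ * ‖x‖ ^ m ≤ ‖αlim m‖ * ‖x‖ ^ m + ε := by
      rw [eventually_all_finset]
      intro m hm
      rw [mem_Icc] at hm
      exact ((hα m hm.1 hm.2).norm.mul_const (‖x‖ ^ m)).eventually_le_const (by linarith)
    rw [← map_add_atTop_eq_nat 1, eventually_map]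
    filter_upwards [hev] with n hn
    rw [hrec, sum_mul]
    refine (norm_sum_le _ _).trans (sum_le_sum fun m hm => ?_)
    split_ifs with hmn
    · calc ‖α m n * d (n + 1 - m) * x ^ (n + 1)‖
          = ‖α m n‖ * ‖x‖ ^ m * ‖d (n + 1 - m) * x ^ (n + 1 - m)‖ := by
            conv_lhs => rw [← Nat.add_sub_cancel' hmn, pow_add, Nat.add_sub_cancel' hmn]
            simp only [norm_mul, norm_pow]
            ring
        _ ≤ _ := mul_le_mul_of_nonneg_right (hn m hm) (norm_nonneg _)
    · simp
end

section
/- Let (A_n) and (B_n) be sequences of complex numbers and (d_n) a sequence of complex numbers satisfying d_{n+1} = A_n d_n + B_n d_{n−1} for all n ≥ 1. Fix N ≥ 1 and define real sequences (c̄_n) and (ĉ_n) by c̄_0 = 1, c̄_1 = |A_N|, c̄_{n+1} = |A_{N+n}| c̄_n + |B_{N+n}| c̄_{n−1} for n ≥ 1, and ĉ_0 = 1, ĉ_1 = |A_{N+1}|, ĉ_{n+1} = |A_{N+1+n}| ĉ_n + |B_{N+1+n}| ĉ_{n−1} for n ≥ 1. Then for every integer j ≥ 1, |d_{N+j}| ≤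 c̄_j |d_N| + ĉ_{j−1} |B_N| |d_{N−1}|. Consequently, for every x ∈ ℂ, ∑_{n=0}^{∞} |d_n| |x|^n ≤ ∑_{n=0}^{N} |d_n| |x|^n + |d_N| |x|^N ∑_{i=1}^{∞} c̄_i |x|^i + |B_N| |d_{N−1}| |x|^{N+1} ∑_{i=0}^{∞} ĉ_i |x|^i (as an inequality of values in [0, ∞]). -/
/-- Norm bound for one step of a three-term recurrence. -/
theorem norm_three_term_le {a b u v w : ℂ} {U V : ℝ} (hw : w = a * u + b * v)
    (hu : ‖u‖ ≤ U) (hv : ‖v‖ ≤ V) : ‖w‖ ≤ ‖a‖ * U + ‖b‖ * V := by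
  rw [hw]
  refine (norm_add_le _ _).trans ?_
  rw [norm_mul, norm_mul]
  gcongr

/-- If `d (n+1) = A n * d n + B n * d (n-1)` for `n ≥ 1` and `cbar`, `chat`
are the solutions of the corresponding recurrences with the moduli of the coefficients,
started at indices `N` and `N+1`, then `‖d (N+j)‖ ≤ cbar j * ‖d N‖ + chat (j-1) * ‖B N‖ * ‖d (N-1)‖`
for every `j ≥ 1`; consequently, for every `x : ℂ` the series of absolute values
`∑ ‖d n‖ ‖x‖^n` is dominated (in `[0,∞]`) by
`∑_{n=0}^{N} ‖d n‖‖x‖^n + ‖d N‖‖x‖^N ∑_{i≥1} cbar i ‖x‖^i + ‖B N‖‖d (N-1)‖‖x‖^{N+1} ∑_{i≥0} chat i ‖x‖^i`. -/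
theorem stmt_11 (A B : ℕ → ℂ) (d : ℕ → ℂ)
    (hd : ∀ n : ℕ, 1 ≤ n → d (n + 1) = A n * d n + B n * d (n - 1))
    (N : ℕ) (hN : 1 ≤ N)
    (cbar chat : ℕ → ℝ)
    (hcbar0 : cbar 0 = 1) (hcbar1 : cbar 1 = ‖A N‖)
    (hcbar : ∀ n : ℕ, 1 ≤ n →
      cbar (n + 1) = ‖A (N + n)‖ * cbar n + ‖B (N + n)‖ * cbar (n - 1))
    (hchat0 : chat 0 = 1) (hchat1 : chat 1 = ‖A (N + 1)‖)
    (hchat : ∀ n : ℕ, 1 ≤ n →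
      chat (n + 1) = ‖A (N + 1 + n)‖ * chat n + ‖B (N + 1 + n)‖ * chat (n - 1)) :
    (∀ j : ℕ, 1 ≤ j →
      ‖d (N + j)‖ ≤ cbar j * ‖d N‖ + chat (j - 1) * ‖B N‖ * ‖d (N - 1)‖) ∧
    ∀ x : ℂ,
      ∑' n : ℕ, ENNReal.ofReal (‖d n‖ * ‖x‖ ^ n) ≤
        (∑ n ∈ Finset.range (N + 1), ENNReal.ofReal (‖d n‖ * ‖x‖ ^ n)) +
        ENNReal.ofReal (‖d N‖ * ‖x‖ ^ N) *
          (∑' i : ℕ, ENNReal.ofReal (cbar (i + 1) * ‖x‖ ^ (i + 1))) +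
        ENNReal.ofReal (‖B N‖ * ‖d (N - 1)‖ * ‖x‖ ^ (N + 1)) *
          (∑' i : ℕ, ENNReal.ofReal (chat i * ‖x‖ ^ i)) := by
  have key : ∀ k : ℕ,
      ‖d (N + (k + 1))‖ ≤ cbar (k + 1) * ‖d N‖ + chat k * ‖B N‖ * ‖d (N - 1)‖ := by
    intro k
    induction k using Nat.twoStepInduction with
    | zero =>
      refine (norm_three_term_le (hd N hN) le_rfl le_rfl).trans_eq ?_
      rw [zero_add, hcbar1, hchat0]
      ring
    | one =>
      have h1 := norm_three_term_le (hd N hN) le_rfl le_rfl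
      refine (norm_three_term_le (hd (N + 1) (by omega)) h1 le_rfl).trans_eq ?_
      rw [hcbar 1 le_rfl, hcbar1, hcbar0, hchat1]
      simp only [Nat.add_sub_cancel]
      ring
    | more k ih0 ih1 =>
      refine (norm_three_term_le (hd (N + (k + 2)) (by omega)) ih1 ih0).trans_eq ?_
      rw [hcbar (k + 2) (by omega), hchat (k + 1) (by omega),
        show N + 1 + (k + 1) = N + (k + 2) by ring]
      simp only [Nat.add_sub_cancel, show k + 2 - 1 = k + 1 by omega]
      ring
  refine ⟨fun j hj => ?_, fun x => ?_⟩
  · obtain ⟨k, rfl⟩ := Nat.exists_eq_add_of_le' hj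
    exact key k
  · rw [← Summable.sum_add_tsum_nat_add' (k := N + 1) ENNReal.summable, add_assoc,
      ← ENNReal.tsum_mul_left, ← ENNReal.tsum_mul_left, ← ENNReal.tsum_add]
    gcongr with i
    rw [← ENNReal.ofReal_mul (by positivity), ← ENNReal.ofReal_mul (by positivity)]
    refine le_trans (ENNReal.ofReal_le_ofReal ?_) ENNReal.ofReal_add_le
    rw [show i + (N + 1) = N + (i + 1) by ring]
    refine (mul_le_mul_of_nonneg_right (key i) (by positivity)).trans_eq ?_
    ring
end
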